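/- Let P(t) = a t^4 + b t^3 + c t^2 + d t + e with a > 0 and e > 0, and let Δ = 4(12ae − 3bd + c^2)^3 − (72ace + 9bcd − 2c^3 − 27ad^2 − 27b^2 e)^2. Then P(t) ≥ 0 for all real t if and only if Δ ≥ 0, |b√e − d√a| ≤ 4√(ace + 2ae√(ae)), and either (i) −2√(ae) ≤ c ≤ 6√(ae), or (ii) c > 6√(ae) and |b√e + d√a| ≤ 4√(ace − 2ae√(ae)). -/

import Mathlib

/-- A nonnegative quadratic remainder: if `y ^ 2 * ((y + s) ^ 2 + k)` is nonnegative for all `y`,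
then `k` is nonnegative. -/
lemma nonneg_of_forall_sq_mul_nonneg {s k : ℝ} (h : ∀ y : ℝ, 0 ≤ y ^ 2 * ((y + s) ^ 2 + k)) :
    0 ≤ k := by
  by_contra! hk
  rcases eq_or_ne s 0 with rfl | hs
  · have h1 := h (Real.sqrt (-k / 2))
    rw [add_zero, Real.sq_sqrt (by linarith)] at h1
    nlinarith
  · have h1 := h (-s)
    have h2 : 0 < s ^ 2 := by positivity
    nlinarith

lemma exists_forall_quartic_le (p q r : ℝ) : ∃ t₀ : ℝ, ∀ t : ℝ,
    t₀ ^ 4 + p * t₀ ^ 3 + q * t₀ ^ 2 + r * t₀ + 1 ≤ t ^ 4 + p * t ^ 3 + q * t ^ 2 + r * t + 1 := by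
  set M : ℝ := 1 + |p| + |q| + |r| with hM
  have hp := abs_nonneg p
  have hq := abs_nonneg q
  have hr := abs_nonneg r
  obtain ⟨t₀, -, ht₀⟩ := (isCompact_Icc (a := -M) (b := M)).exists_isMinOn
    ⟨0, by constructor <;> linarith⟩
    (f := fun t : ℝ => t ^ 4 + p * t ^ 3 + q * t ^ 2 + r * t + 1) (by fun_prop)
  refine ⟨t₀, fun t => ?_⟩
  by_cases ht : |t| ≤ M
  · exact ht₀ (abs_le.mp ht)
  · have h0 : t₀ ^ 4 + p * t₀ ^ 3 + q * t₀ ^ 2 + r * t₀ + 1 ≤ 1 := by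
      simpa using ht₀ (show (0 : ℝ) ∈ Set.Icc (-M) M by constructor <;> linarith)
    refine h0.trans ?_
    push Not at ht
    set x := |t| with hx
    have hx1 : 1 ≤ x := by linarith
    have e4 : t ^ 4 = x ^ 4 := by rw [hx, (by decide : Even 4).pow_abs]
    have e3 : -(|p| * x ^ 3) ≤ p * t ^ 3 := by
      rw [hx, ← abs_pow, ← abs_mul]; exact neg_abs_le _
    have e2 : -(|q| * x ^ 2) ≤ q * t ^ 2 := by
      rw [hx, ← abs_pow, ← abs_mul]; exact neg_abs_le _
    have e1 : -(|r| * x) ≤ r * t := by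
      rw [hx, ← abs_mul]; exact neg_abs_le _
    have f2 : |q| * x ^ 2 ≤ |q| * x ^ 3 :=
      mul_le_mul_of_nonneg_left (pow_le_pow_right₀ hx1 (by norm_num)) hq
    have f1 : |r| * x ≤ |r| * x ^ 3 :=
      mul_le_mul_of_nonneg_left (le_self_pow₀ hx1 (by norm_num)) hr
    have f0 : (|p| + |q| + |r|) * x ^ 3 ≤ x * x ^ 3 :=
      mul_le_mul_of_nonneg_right (by linarith) (by positivity)
    nlinarith

/-- A nonnegative quartic `t ^ 4 + p t ^ 3 + q t ^ 2 + r t + 1` has the form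
`((t - t₀) (t + s)) ^ 2 + k (t - t₀) ^ 2 + m` with `k, m ≥ 0`. -/
lemma exists_sum_sq_of_quartic_nonneg {p q r : ℝ}
    (h : ∀ t : ℝ, 0 ≤ t ^ 4 + p * t ^ 3 + q * t ^ 2 + r * t + 1) :
    ∃ t₀ s k m : ℝ, 0 ≤ k ∧ 0 ≤ m ∧ p = 2 * (s - t₀) ∧ q = (s - t₀) ^ 2 - 2 * s * t₀ + k ∧
      r = -2 * (s - t₀) * (s * t₀) - 2 * k * t₀ ∧ 1 = s ^ 2 * t₀ ^ 2 + k * t₀ ^ 2 + m := by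
  obtain ⟨t₀, ht₀⟩ := exists_forall_quartic_le p q r
  have hder : HasDerivAt (fun t : ℝ => t ^ 4 + p * t ^ 3 + q * t ^ 2 + r * t + 1)
      (4 * t₀ ^ 3 + 3 * p * t₀ ^ 2 + 2 * q * t₀ + r) t₀ := by
    refine HasDerivAt.congr_deriv (((((hasDerivAt_pow 4 t₀).add
      ((hasDerivAt_pow 3 t₀).const_mul p)).add ((hasDerivAt_pow 2 t₀).const_mul q)).add
      ((hasDerivAt_id t₀).const_mul r)).add_const 1) ?_
    push_cast
    ring
  have hcrit := IsLocalMin.hasDerivAt_eq_zero (Filter.Eventually.of_forall ht₀) hder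
  have hr : r = -(4 * t₀ ^ 3 + 3 * p * t₀ ^ 2 + 2 * q * t₀) := by linarith
  refine ⟨t₀, p / 2 + t₀, q - (p / 2) ^ 2 + 2 * (p / 2 + t₀) * t₀,
    t₀ ^ 4 + p * t₀ ^ 3 + q * t₀ ^ 2 + r * t₀ + 1, ?_, h t₀, by ring, by ring, ?_, ?_⟩
  · refine nonneg_of_forall_sq_mul_nonneg (s := p / 2 + 2 * t₀) fun y => ?_
    have := ht₀ (y + t₀)
    rw [hr] at this
    linarith
  · rw [hr]; ring
  · rw [hr]; ring

lemma quartic_nonneg_of_gram_det_nonneg {p q r x : ℝ} (hx : x ^ 2 < 1)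
    (h : 0 ≤ 2 * x ^ 3 - q * x ^ 2 + (p * r / 2 - 2) * x + q - (p ^ 2 + r ^ 2) / 4) (t : ℝ) :
    0 ≤ t ^ 4 + p * t ^ 3 + q * t ^ 2 + r * t + 1 := by
  have hpos : 0 < 1 - x ^ 2 := by linarith
  refine nonneg_of_mul_nonneg_right (a := 1 - x ^ 2) ?_ hpos
  have key : (1 - x ^ 2) * (t ^ 4 + p * t ^ 3 + q * t ^ 2 + r * t + 1) =
      (1 - x ^ 2) * (t ^ 2 + p / 2 * t + x) ^ 2 + ((1 - x ^ 2) + (r - p * x) * t / 2) ^ 2 +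
        (2 * x ^ 3 - q * x ^ 2 + (p * r / 2 - 2) * x + q - (p ^ 2 + r ^ 2) / 4) * t ^ 2 := by
    ring
  rw [key]
  positivity

/-- The discriminant of a normalized quartic whose resolvent cubic is
`2 (x - u) (x ^ 2 - S x + T)`. -/
lemma discriminant_eq_of_resolvent_factor {p q r u S T : ℝ} (hq : q = 2 * (u + S))
    (hpr : p * r = 4 + 4 * (u * S + T)) (hsum : p ^ 2 + r ^ 2 = 4 * q + 8 * (u * T)) :
    4 * (12 - 3 * p * r + q ^ 2) ^ 3 -
      (72 * q + 9 * p * q * r - 2 * q ^ 3 - 27 * r ^ 2 - 27 * p ^ 2) ^ 2 =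
      1728 * ((S ^ 2 - 4 * T) * (u ^ 2 - S * u + T) ^ 2) := by
  have e1 : 12 - 3 * p * r + q ^ 2 = 12 - 3 * (4 + 4 * (u * S + T)) + q ^ 2 := by
    rw [← hpr]; ring
  have e2 : 72 * q + 9 * p * q * r - 2 * q ^ 3 - 27 * r ^ 2 - 27 * p ^ 2 =
      72 * q + 9 * q * (4 + 4 * (u * S + T)) - 2 * q ^ 3 - 27 * (4 * q + 8 * (u * T)) := by
    rw [← hpr, ← hsum]; ring
  rw [e1, e2, hq]
  ring

/-- The resolvent cubic of a normalized quartic splits over the reals as soon as the discriminant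
of the quartic is nonnegative. -/
lemma exists_resolvent_roots {p q r : ℝ}
    (h : 0 ≤ 4 * (12 - 3 * p * r + q ^ 2) ^ 3 -
      (72 * q + 9 * p * q * r - 2 * q ^ 3 - 27 * r ^ 2 - 27 * p ^ 2) ^ 2) :
    ∃ u v w : ℝ, 1 ≤ u ∧ q = 2 * (u + v + w) ∧ p * r = 4 + 4 * (u * v + u * w + v * w) ∧
      p ^ 2 + r ^ 2 = 4 * q + 8 * (u * v * w) := by
  set f : ℝ → ℝ := fun x => 2 * x ^ 3 - q * x ^ 2 + (p * r / 2 - 2) * x + q - (p ^ 2 + r ^ 2) / 4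
    with hf
  have hf1 : f 1 ≤ 0 := by simp only [hf]; nlinarith [sq_nonneg (p - r)]
  obtain ⟨M, hM1, hM⟩ : ∃ M, 1 ≤ M ∧ 0 ≤ f M := by
    set A := |q| + |p * r / 2 - 2| + |q - (p ^ 2 + r ^ 2) / 4| with hA
    have a1 := abs_nonneg q
    have a2 := abs_nonneg (p * r / 2 - 2)
    have a3 := abs_nonneg (q - (p ^ 2 + r ^ 2) / 4)
    have hA1 : (1 : ℝ) ≤ 1 + A := by linarith
    refine ⟨1 + A, hA1, ?_⟩
    set M := 1 + A with hMdef
    have b1 : q * M ^ 2 ≤ |q| * M ^ 2 := mul_le_mul_of_nonneg_right (le_abs_self q) (by positivity)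
    have b2 : -(|p * r / 2 - 2| * M) ≤ (p * r / 2 - 2) * M := by
      rw [← neg_mul]; exact mul_le_mul_of_nonneg_right (neg_abs_le _) (by linarith)
    have b3 := neg_abs_le (q - (p ^ 2 + r ^ 2) / 4)
    have c2 : |p * r / 2 - 2| * M ≤ |p * r / 2 - 2| * M ^ 2 :=
      mul_le_mul_of_nonneg_left (le_self_pow₀ hA1 (by norm_num)) a2
    have c3 : |q - (p ^ 2 + r ^ 2) / 4| * 1 ≤ |q - (p ^ 2 + r ^ 2) / 4| * M ^ 2 :=
      mul_le_mul_of_nonneg_left (one_le_pow₀ hA1) a3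
    have c0 : A * M ^ 2 ≤ M * M ^ 2 := mul_le_mul_of_nonneg_right (by linarith) (by positivity)
    have c4 : 0 ≤ M ^ 3 := by positivity
    simp only [hf]
    nlinarith
  obtain ⟨u, ⟨hu1, -⟩, hu⟩ := intermediate_value_Icc hM1 (f := f) (by fun_prop) ⟨hf1, hM⟩
  simp only [hf] at hu
  -- the cofactor of `2 * (x - u)` is `x ^ 2 - S * x + T`
  obtain ⟨S, hS⟩ : ∃ S, S = q / 2 - u := ⟨_, rfl⟩
  obtain ⟨T, hT⟩ : ∃ T, T = p * r / 4 - 1 - u * S := ⟨_, rfl⟩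
  have hq : q = 2 * (u + S) := by linarith
  have hpr : p * r = 4 + 4 * (u * S + T) := by linarith
  have hsum : p ^ 2 + r ^ 2 = 4 * q + 8 * (u * T) := by
    rw [hpr, hq] at hu
    rw [hq]
    linear_combination -4 * hu
  have hdisc : 0 ≤ (S ^ 2 - 4 * T) * (u ^ 2 - S * u + T) ^ 2 := by
    rw [discriminant_eq_of_resolvent_factor hq hpr hsum] at h
    linarith
  have hD : 0 ≤ S ^ 2 - 4 * T := by
    rcases eq_or_ne (u ^ 2 - S * u + T) 0 with h0 | h0
    · nlinarith [sq_nonneg (2 * u - S)]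
    · exact nonneg_of_mul_nonneg_left hdisc (by positivity)
  have hsq := Real.sq_sqrt hD
  refine ⟨u, (S + Real.sqrt (S ^ 2 - 4 * T)) / 2, (S - Real.sqrt (S ^ 2 - 4 * T)) / 2, hu1, ?_,
    ?_, ?_⟩
  · rw [hq]; ring
  · rw [hpr]; linear_combination hsq
  · rw [hsum]; linear_combination 2 * u * hsq

lemma normalized_quartic_nonneg_of_conditions {p q r : ℝ}
    (hΔ : 0 ≤ 4 * (12 - 3 * p * r + q ^ 2) ^ 3 -
      (72 * q + 9 * p * q * r - 2 * q ^ 3 - 27 * r ^ 2 - 27 * p ^ 2) ^ 2)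
    (hsub : (p - r) ^ 2 ≤ 16 * (q + 2))
    (hadd : 6 < q → (p + r) ^ 2 ≤ 16 * (q - 2)) (t : ℝ) :
    0 ≤ t ^ 4 + p * t ^ 3 + q * t ^ 2 + r * t + 1 := by
  obtain ⟨u, v, w, hu, hq, hpr, hsum⟩ := exists_resolvent_roots hΔ
  have hf (x : ℝ) : 2 * x ^ 3 - q * x ^ 2 + (p * r / 2 - 2) * x + q - (p ^ 2 + r ^ 2) / 4 =
      2 * ((x - u) * (x - v) * (x - w)) := by
    rw [hpr, hsum, hq]; ring
  have hsub' : (p - r) ^ 2 = 8 * ((u - 1) * (v - 1) * (w - 1)) := by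
    linear_combination hsum - 2 * hpr + 4 * hq
  have hadd' : (p + r) ^ 2 = 8 * ((u + 1) * (v + 1) * (w + 1)) := by
    linear_combination hsum + 2 * hpr + 4 * hq
  have double_one (h1 : (u - 1) * (v - 1) = 0) (h2 : (u - 1) * (w - 1) = 0)
      (h3 : (v - 1) * (w - 1) = 0) : 0 ≤ t ^ 4 + p * t ^ 3 + q * t ^ 2 + r * t + 1 := by
    have h0 : p - r = 0 := by
      rw [← sq_eq_zero_iff, hsub', h1]; ring
    have hr : r = p := by linarith
    subst hr
    have hq' : q = r ^ 2 / 4 + 2 := by linear_combination hq - hpr / 4 - h1 - h2 - h3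
    have : t ^ 4 + r * t ^ 3 + q * t ^ 2 + r * t + 1 = (t ^ 2 + r / 2 * t + 1) ^ 2 := by
      rw [hq']; ring
    rw [this]
    positivity
  by_cases hv : v ^ 2 < 1
  · exact quartic_nonneg_of_gram_det_nonneg hv (by rw [hf]; simp) t
  by_cases hw : w ^ 2 < 1
  · exact quartic_nonneg_of_gram_det_nonneg hw (by rw [hf]; simp) t
  by_cases h0 : u * v * w ≤ 0
  · exact quartic_nonneg_of_gram_det_nonneg (x := 0) (by norm_num) (by rw [hf]; linarith) t
  push Not at hv hw h0
  have hvw : 0 < v * w := by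
    rw [mul_assoc] at h0
    exact pos_of_mul_pos_right h0 (by linarith)
  rcases pos_and_pos_or_neg_and_neg_of_mul_pos hvw with ⟨hv0, hw0⟩ | ⟨hv0, hw0⟩
  · have hv1 : 0 ≤ v - 1 := by nlinarith
    have hw1 : 0 ≤ w - 1 := by nlinarith
    have hu1 : 0 ≤ u - 1 := by linarith
    have m1 := mul_nonneg hu1 hv1
    have m2 := mul_nonneg hu1 hw1
    have m3 := mul_nonneg hv1 hw1
    have m4 := mul_nonneg m1 hw1
    by_cases h6 : 6 < q
    · have := hadd h6
      rw [hadd', hq] at this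
      apply double_one <;> linarith
    · have hu0 : u - 1 = 0 := by linarith
      have hv0 : v - 1 = 0 := by linarith
      apply double_one <;> simp [hu0, hv0]
  · have hv1 : 0 ≤ -1 - v := by nlinarith
    have hw1 : 0 ≤ -1 - w := by nlinarith
    have hu1 : 0 ≤ u - 1 := by linarith
    have m1 := mul_nonneg hu1 hv1
    have m2 := mul_nonneg hu1 hw1
    have m3 := mul_nonneg m1 hw1
    rw [hsub', hq] at hsub
    have hv : v = -1 := by linarith
    have hw : w = -1 := by linarith
    subst hv hw
    have h0 : p + r = 0 := by
      rw [← sq_eq_zero_iff, hadd']; ring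
    have hr : r = -p := by linarith
    subst hr
    have hq' : q = p ^ 2 / 4 - 2 := by linear_combination hq + hpr / 4
    have : t ^ 4 + p * t ^ 3 + q * t ^ 2 + -p * t + 1 = (t ^ 2 + p / 2 * t - 1) ^ 2 := by
      rw [hq']; ring
    rw [this]
    positivity

/-- If the resolvent cubic has a real root `u` and the complementary quadratic factor takes a
nonpositive value at `1`, then the discriminant of the quartic is nonnegative. -/
lemma discriminant_nonneg_of_resolvent_root {p q r u : ℝ}
    (hu : 2 * u ^ 3 - q * u ^ 2 + (p * r / 2 - 2) * u + q - (p ^ 2 + r ^ 2) / 4 = 0)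
    (hq : 1 - (q / 2 - u) + (p * r / 4 - 1 - u * (q / 2 - u)) ≤ 0) :
    0 ≤ 4 * (12 - 3 * p * r + q ^ 2) ^ 3 -
      (72 * q + 9 * p * q * r - 2 * q ^ 3 - 27 * r ^ 2 - 27 * p ^ 2) ^ 2 := by
  obtain ⟨S, hS⟩ : ∃ S, S = q / 2 - u := ⟨_, rfl⟩
  obtain ⟨T, hT⟩ : ∃ T, T = p * r / 4 - 1 - u * S := ⟨_, rfl⟩
  rw [← hS, ← hT] at hq
  have hq' : q = 2 * (u + S) := by linarith
  have hpr : p * r = 4 + 4 * (u * S + T) := by linarith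
  have hsum : p ^ 2 + r ^ 2 = 4 * q + 8 * (u * T) := by
    rw [hpr, hq'] at hu
    rw [hq']
    linear_combination -4 * hu
  have hD : 0 ≤ S ^ 2 - 4 * T := by nlinarith [sq_nonneg (2 - S)]
  rw [discriminant_eq_of_resolvent_factor hq' hpr hsum]
  positivity

lemma conditions_of_normalized_quartic_nonneg {p q r : ℝ}
    (h : ∀ t : ℝ, 0 ≤ t ^ 4 + p * t ^ 3 + q * t ^ 2 + r * t + 1) :
    0 ≤ 4 * (12 - 3 * p * r + q ^ 2) ^ 3 -
      (72 * q + 9 * p * q * r - 2 * q ^ 3 - 27 * r ^ 2 - 27 * p ^ 2) ^ 2 ∧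
    (p - r) ^ 2 ≤ 16 * (q + 2) ∧ (6 < q → (p + r) ^ 2 ≤ 16 * (q - 2)) := by
  obtain ⟨t₀, s, k, m, hk, hm, hp, hq, hr, h1⟩ := exists_sum_sq_of_quartic_nonneg h
  obtain ⟨x, hx⟩ : ∃ x, x = -(s * t₀) := ⟨_, rfl⟩
  have hx2 : x ^ 2 = s ^ 2 * t₀ ^ 2 := by rw [hx]; ring
  have hkt : 0 ≤ k * t₀ ^ 2 := by positivity
  have hxsq : x ^ 2 ≤ 1 := by linarith
  obtain ⟨hxl, hxu⟩ := abs_le.mp ((sq_le_one_iff_abs_le_one x).mp hxsq)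
  have hqx : q - 2 * x = (s - t₀) ^ 2 + k := by rw [hq, hx]; ring
  have hqx0 : 0 ≤ q - 2 * x := by rw [hqx]; positivity
  have hpq : p ^ 2 ≤ 4 * (q - 2 * x) := by rw [hqx, hp]; nlinarith
  have hm' : m = 1 - s ^ 2 * t₀ ^ 2 - k * t₀ ^ 2 := by linarith
  have hdet : 2 * x ^ 3 - q * x ^ 2 + (p * r / 2 - 2) * x + q - (p ^ 2 + r ^ 2) / 4 = k * m := by
    rw [hm', hp, hr, hq, hx]; ring
  have hkm : 0 ≤ k * m := mul_nonneg hk hm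
  have hsub : (p - r) ^ 2 ≤ 4 * (q - 2 * x) * (2 - 2 * x) := by
    have e : 4 * (q - 2 * x) * (2 - 2 * x) - (p - r) ^ 2 =
        4 * (k * ((s - t₀) * t₀ - (1 - x)) ^ 2 + m * ((s - t₀) ^ 2 + k)) := by
      rw [hqx, hp, hr, hm', hx]; ring
    rw [← sub_nonneg, e]
    positivity
  have hadd : (p + r) ^ 2 ≤ 4 * (q - 2 * x) * (2 + 2 * x) := by
    have e : 4 * (q - 2 * x) * (2 + 2 * x) - (p + r) ^ 2 =
        4 * (k * ((s - t₀) * t₀ + (1 + x)) ^ 2 + m * ((s - t₀) ^ 2 + k)) := by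
      rw [hqx, hp, hr, hm', hx]; ring
    rw [← sub_nonneg, e]
    positivity
  refine ⟨?_, ?_, fun h6 => ?_⟩
  · rcases hxu.lt_or_eq with hx1 | hx1
    · obtain ⟨u, ⟨-, hux⟩, hu⟩ := intermediate_value_Icc hxl
        (f := fun x => 2 * x ^ 3 - q * x ^ 2 + (p * r / 2 - 2) * x + q - (p ^ 2 + r ^ 2) / 4)
        (by fun_prop) (show (0 : ℝ) ∈ Set.Icc _ _ from
          ⟨by nlinarith [sq_nonneg (p + r)], by simpa only [hdet] using hkm⟩)
      refine discriminant_nonneg_of_resolvent_root hu ?_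
      have hu1 : 0 < 1 - u := by linarith
      refine nonpos_of_mul_nonpos_right ?_ hu1
      simp only at hu
      nlinarith [sq_nonneg (p - r)]
    · have hpr : r = p := by
        rw [hx1] at hsub
        nlinarith
      rw [hpr] at hdet ⊢
      rw [hx1] at hdet hpq
      refine discriminant_nonneg_of_resolvent_root (u := 1) (by ring) (by nlinarith)
  · have : 0 ≤ (1 + x) * (q + 4 - 2 * x) := mul_nonneg (by linarith) (by linarith)
    linarith
  · have : 0 ≤ (1 - x) * (q - 2 * x - 4) := mul_nonneg (by linarith) (by linarith)
    linarith

lemma normalized_quartic_nonneg_iff (p q r : ℝ) :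
    (∀ t : ℝ, 0 ≤ t ^ 4 + p * t ^ 3 + q * t ^ 2 + r * t + 1) ↔
      0 ≤ 4 * (12 - 3 * p * r + q ^ 2) ^ 3 -
        (72 * q + 9 * p * q * r - 2 * q ^ 3 - 27 * r ^ 2 - 27 * p ^ 2) ^ 2 ∧
      (p - r) ^ 2 ≤ 16 * (q + 2) ∧ (6 < q → (p + r) ^ 2 ≤ 16 * (q - 2)) :=
  ⟨conditions_of_normalized_quartic_nonneg,
    fun h => normalized_quartic_nonneg_of_conditions h.1 h.2.1 h.2.2⟩

lemma abs_le_four_mul_sqrt_iff {K z y : ℝ} (hK : 0 < K) (hy : 0 ≤ y) :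
    |K * z| ≤ 4 * Real.sqrt (K ^ 2 * y) ↔ z ^ 2 ≤ 16 * y := by
  rw [Real.sqrt_mul (by positivity), Real.sqrt_sq hK.le, abs_mul, abs_of_pos hK,
    mul_left_comm, mul_le_mul_iff_right₀ hK, ← abs_of_nonneg (a := 4 * √y) (by positivity),
    ← sq_le_sq, mul_pow, Real.sq_sqrt hy]
  norm_num

theorem quartic_nonneg_iff (a b c d e : ℝ) (ha : 0 < a) (he : 0 < e) :
    (∀ t : ℝ, 0 ≤ a * t ^ 4 + b * t ^ 3 + c * t ^ 2 + d * t + e) ↔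
      (0 ≤ 4 * (12 * a * e - 3 * b * d + c ^ 2) ^ 3 -
          (72 * a * c * e + 9 * b * c * d - 2 * c ^ 3 - 27 * a * d ^ 2 -
            27 * b ^ 2 * e) ^ 2 ∧
        |b * Real.sqrt e - d * Real.sqrt a| ≤
          4 * Real.sqrt (a * c * e + 2 * a * e * Real.sqrt (a * e)) ∧
        ((-2 * Real.sqrt (a * e) ≤ c ∧ c ≤ 6 * Real.sqrt (a * e)) ∨
          (6 * Real.sqrt (a * e) < c ∧
            |b * Real.sqrt e + d * Real.sqrt a| ≤
              4 * Real.sqrt (a * c * e - 2 * a * e * Real.sqrt (a * e))))) := by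
  obtain ⟨A, hA, rfl⟩ : ∃ A : ℝ, 0 < A ∧ A ^ 4 = a :=
    ⟨√√a, by positivity, by
      rw [show 4 = 2 * 2 from rfl, pow_mul, Real.sq_sqrt (by positivity), Real.sq_sqrt ha.le]⟩
  obtain ⟨E, hE, rfl⟩ : ∃ E : ℝ, 0 < E ∧ E ^ 4 = e :=
    ⟨√√e, by positivity, by
      rw [show 4 = 2 * 2 from rfl, pow_mul, Real.sq_sqrt (by positivity), Real.sq_sqrt he.le]⟩
  obtain ⟨p, rfl⟩ : ∃ p, b = A ^ 3 * E * p := ⟨b / (A ^ 3 * E), by field_simp⟩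
  obtain ⟨q, rfl⟩ : ∃ q, c = A ^ 2 * E ^ 2 * q := ⟨c / (A ^ 2 * E ^ 2), by field_simp⟩
  obtain ⟨r, rfl⟩ : ∃ r, d = A * E ^ 3 * r := ⟨d / (A * E ^ 3), by field_simp⟩
  have sA : √(A ^ 4) = A ^ 2 := by
    rw [show A ^ 4 = (A ^ 2) ^ 2 by ring, Real.sqrt_sq (by positivity)]
  have sE : √(E ^ 4) = E ^ 2 := by
    rw [show E ^ 4 = (E ^ 2) ^ 2 by ring, Real.sqrt_sq (by positivity)]
  have sAE : √(A ^ 4 * E ^ 4) = A ^ 2 * E ^ 2 := by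
    rw [Real.sqrt_mul (by positivity), sA, sE]
  have hK2 : 0 < A ^ 2 * E ^ 2 := by positivity
  have hK3 : 0 < A ^ 3 * E ^ 3 := by positivity
  have hP : (∀ t : ℝ, 0 ≤ A ^ 4 * t ^ 4 + A ^ 3 * E * p * t ^ 3 + A ^ 2 * E ^ 2 * q * t ^ 2 +
      A * E ^ 3 * r * t + E ^ 4) ↔
      ∀ t : ℝ, 0 ≤ t ^ 4 + p * t ^ 3 + q * t ^ 2 + r * t + 1 := by
    have key (t : ℝ) : A ^ 4 * (E / A * t) ^ 4 + A ^ 3 * E * p * (E / A * t) ^ 3 +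
        A ^ 2 * E ^ 2 * q * (E / A * t) ^ 2 + A * E ^ 3 * r * (E / A * t) + E ^ 4 =
        E ^ 4 * (t ^ 4 + p * t ^ 3 + q * t ^ 2 + r * t + 1) := by
      field_simp
    rw [(mul_left_surjective₀ (div_pos hE hA).ne').forall]
    simp only [key, mul_nonneg_iff_of_pos_left (pow_pos hE 4)]
  have hΔ : 4 * (12 * A ^ 4 * E ^ 4 - 3 * (A ^ 3 * E * p) * (A * E ^ 3 * r) +
      (A ^ 2 * E ^ 2 * q) ^ 2) ^ 3 -
      (72 * A ^ 4 * (A ^ 2 * E ^ 2 * q) * E ^ 4 +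
        9 * (A ^ 3 * E * p) * (A ^ 2 * E ^ 2 * q) * (A * E ^ 3 * r) -
        2 * (A ^ 2 * E ^ 2 * q) ^ 3 - 27 * A ^ 4 * (A * E ^ 3 * r) ^ 2 -
        27 * (A ^ 3 * E * p) ^ 2 * E ^ 4) ^ 2 =
      (A ^ 12 * E ^ 12) * (4 * (12 - 3 * p * r + q ^ 2) ^ 3 -
        (72 * q + 9 * p * q * r - 2 * q ^ 3 - 27 * r ^ 2 - 27 * p ^ 2) ^ 2) := by
    ring
  rw [hP, normalized_quartic_nonneg_iff, hΔ, mul_nonneg_iff_of_pos_left (by positivity), sAE, sA,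
    sE, show A ^ 3 * E * p * E ^ 2 - A * E ^ 3 * r * A ^ 2 = A ^ 3 * E ^ 3 * (p - r) by ring,
    show A ^ 3 * E * p * E ^ 2 + A * E ^ 3 * r * A ^ 2 = A ^ 3 * E ^ 3 * (p + r) by ring,
    show A ^ 4 * (A ^ 2 * E ^ 2 * q) * E ^ 4 + 2 * A ^ 4 * E ^ 4 * (A ^ 2 * E ^ 2) =
      (A ^ 3 * E ^ 3) ^ 2 * (q + 2) by ring,
    show A ^ 4 * (A ^ 2 * E ^ 2 * q) * E ^ 4 - 2 * A ^ 4 * E ^ 4 * (A ^ 2 * E ^ 2) =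
      (A ^ 3 * E ^ 3) ^ 2 * (q - 2) by ring,
    mul_comm (-2), mul_comm 6, mul_le_mul_iff_right₀ hK2, mul_le_mul_iff_right₀ hK2,
    mul_lt_mul_iff_right₀ hK2]
  refine and_congr_right fun _ => ?_
  by_cases hq : -2 ≤ q
  · rw [abs_le_four_mul_sqrt_iff hK3 (by linarith)]
    refine and_congr_right fun _ => ?_
    by_cases h6 : 6 < q
    · rw [abs_le_four_mul_sqrt_iff hK3 (by linarith)]
      simp [h6, not_le.mpr h6]
    · simp [h6, hq, not_lt.mp h6]
  · push Not at hq
    constructor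
    · rintro ⟨h, -⟩
      nlinarith [sq_nonneg (p - r)]
    · rintro ⟨-, ⟨h, -⟩ | ⟨h, -⟩⟩ <;> linarith
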